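/- arXiv:2211.13821 — 2 statements merged into one kernel-verified Lean document; each statement's English description precedes it below -/
import Mathlib

section
/- Let Σ be a nonempty directed partial order and ({X^σ}, {α_τ^σ}) an inverse system in cmn over Σ in which every arrow α_τ^σ (σ ≤ τ) is surjective. Then the following are equivalent: (1) the system has an inverse limit in cmn; (2) the family {X^σ} is bounded above with respect to ≼, i.e. there exists a nonempty compact metric space Y with X^σ ≼ Y for all σ; (3) it is bounded above with respect to ≼_s; (4) it is bounded above with respect to ≼_i; (5) there exists a nonempty compact metric space Y such that X^σ ≼ Y, X^σ ≼_s Y and X^σ ≼_i Y for every σ; (6) the family {X^σ} is uniformly compact. -/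
open GromovHausdorff Filter Topology

/-- A map between metric spaces is non-expansive. -/
def IsNonexpansive {X Y : Type} [MetricSpace X] [MetricSpace Y] (f : X → Y) : Prop :=
  ∀ a b : X, dist (f a) (f b) ≤ dist a b

/-- `X ≼ Y`: there is a non-expansive surjection from `Y` onto `X`. -/
def DomOrder (X Y : Type) [MetricSpace X] [MetricSpace Y] : Prop :=
  ∃ f : Y → X, IsNonexpansive f ∧ Function.Surjective f

/-- `X ≼ₛ Y`: `X ≼ K` for some nonempty closed subset `K` of `Y`. -/
def DomOrderSub (X Y : Type) [MetricSpace X] [MetricSpace Y] : Prop :=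
  ∃ K : Set Y, K.Nonempty ∧ IsClosed K ∧ DomOrder X K

/-- `X ≼ᵢ Y`: `X` is isometric to a subset of `Y`. -/
def DomOrderIso (X Y : Type) [MetricSpace X] [MetricSpace Y] : Prop :=
  ∃ f : X → Y, Isometry f

/-- `(L, f)` is an inverse limit in cmn of the inverse system `({X σ}, {α τ σ})`. -/
def IsInverseLimit (I : Type) [PartialOrder I]
    (X : I → Type) [∀ σ, MetricSpace (X σ)]
    (α : ∀ σ τ : I, σ ≤ τ → X τ → X σ)
    (L : Type) [MetricSpace L] [CompactSpace L] [Nonempty L]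
    (f : ∀ σ, L → X σ) : Prop :=
  (∀ σ, IsNonexpansive (f σ)) ∧
  (∀ (σ τ : I) (h : σ ≤ τ) (x : L), α σ τ h (f τ x) = f σ x) ∧
  (∀ (Z : Type) (_ : MetricSpace Z) (_ : CompactSpace Z) (_ : Nonempty Z)
    (ξ : ∀ σ, Z → X σ),
    (∀ σ, IsNonexpansive (ξ σ)) →
    (∀ (σ τ : I) (h : σ ≤ τ) (z : Z), α σ τ h (ξ τ z) = ξ σ z) →
    ∃! ν : Z → L, IsNonexpansive ν ∧ ∀ (σ : I) (z : Z), f σ (ν z) = ξ σ z)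

/-- A family of nonempty compact metric spaces is uniformly compact: the diameters are
uniformly bounded and for every `ε > 0` there is `N` such that every member of the
family has an `ε`-dense subset with at most `N` elements. -/
def UniformlyCompact (I : Type) (X : I → Type) [∀ σ, MetricSpace (X σ)] : Prop :=
  (∃ C : ℝ, ∀ σ, Metric.diam (Set.univ : Set (X σ)) ≤ C) ∧
  ∀ ε : ℝ, 0 < ε → ∃ N : ℕ, ∀ σ, ∃ s : Finset (X σ),
    s.card ≤ N ∧ ∀ x : X σ, ∃ y ∈ s, dist x y < ε

theorem IsNonexpansive.continuous {X Y : Type} [MetricSpace X] [MetricSpace Y] {f : X → Y}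
    (hf : IsNonexpansive f) : Continuous f :=
  (LipschitzWith.of_dist_le_mul (K := 1) (by simpa [IsNonexpansive] using hf)).continuous

/-- Every finite `ε`-separated subset of `X` has at most `N` points. -/
def PackingBound (X : Type) [MetricSpace X] (ε : ℝ) (N : ℕ) : Prop :=
  ∀ s : Finset X, (∀ a ∈ s, ∀ b ∈ s, a ≠ b → ε ≤ dist a b) → s.card ≤ N

theorem PackingBound.exists_net {X : Type} [MetricSpace X] {ε : ℝ} {N : ℕ}
    (hε : 0 < ε) (h : PackingBound X ε N) :
    ∃ s : Finset X, s.card ≤ N ∧ ∀ x : X, ∃ y ∈ s, dist x y < ε := by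
  classical
  by_contra! hcon
  have key : ∀ n ≤ N + 1, ∃ s : Finset X,
      s.card = n ∧ ∀ a ∈ s, ∀ b ∈ s, a ≠ b → ε ≤ dist a b := by
    intro n
    induction n with
    | zero => exact fun _ => ⟨∅, by simp⟩
    | succ n ih =>
      intro hn
      obtain ⟨s, hs, hsep⟩ := ih (by omega)
      obtain ⟨x, hx⟩ := hcon s (by omega)
      have hxs : x ∉ s := fun hxs => (hx x hxs).not_gt (by simpa using hε)
      refine ⟨insert x s, by rw [Finset.card_insert_of_notMem hxs, hs], ?_⟩
      intro a ha b hb hab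
      rw [Finset.mem_insert] at ha hb
      rcases ha with rfl | ha <;> rcases hb with rfl | hb
      · exact absurd rfl hab
      · exact hx b hb
      · rw [dist_comm]; exact hx a ha
      · exact hsep a ha b hb hab
  obtain ⟨s, hs, hsep⟩ := key (N + 1) le_rfl
  have := h s hsep
  omega

theorem packingBound_of_net {X : Type} [MetricSpace X] {ε : ℝ} {N : ℕ} (t : Finset X)
    (ht : t.card ≤ N) (hnet : ∀ x : X, ∃ y ∈ t, dist x y < ε / 2) : PackingBound X ε N := by
  intro s hs
  choose g hgt hg using hnet
  refine (Finset.card_le_card_of_injOn (s := s) g (fun x _ => hgt x) ?_).trans ht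
  intro a ha b hb hab
  by_contra hne
  have h₁ := hs a (Finset.mem_coe.1 ha) b (Finset.mem_coe.1 hb) hne
  have h₂ := dist_triangle_right a b (g a)
  have h₃ := hg a
  have h₄ := hg b
  rw [← hab] at h₄
  linarith

theorem exists_packingBound (Y : Type) [MetricSpace Y] [CompactSpace Y] {ε : ℝ} (hε : 0 < ε) :
    ∃ N, PackingBound Y ε N := by
  obtain ⟨t, -, htf, ht⟩ :=
    finite_cover_balls_of_compact (isCompact_univ (X := Y)) (half_pos hε)
  refine ⟨htf.toFinset.card, packingBound_of_net htf.toFinset le_rfl fun x => ?_⟩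
  simpa using ht (Set.mem_univ x)

theorem PackingBound.of_expanding {X Y : Type} [MetricSpace X] [MetricSpace Y] {ε : ℝ} {N : ℕ}
    (h : PackingBound Y ε N) (g : X → Y) (hg : ∀ a b, dist a b ≤ dist (g a) (g b)) :
    PackingBound X ε N := by
  classical
  have hinj : Function.Injective g := fun a b hab =>
    dist_le_zero.1 ((hg a b).trans (by rw [hab, dist_self]))
  intro s hs
  rw [← Finset.card_image_of_injective s hinj]
  refine h _ fun x hx y hy hxy => ?_
  obtain ⟨a, ha, rfl⟩ := Finset.mem_image.1 hx
  obtain ⟨b, hb, rfl⟩ := Finset.mem_image.1 hy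
  exact (hs a ha b hb fun h => hxy (h ▸ rfl)).trans (hg a b)

theorem dist_le_diam_univ {Y : Type} [MetricSpace Y] [CompactSpace Y] (a b : Y) :
    dist a b ≤ Metric.diam (Set.univ : Set Y) :=
  Metric.dist_le_diam_of_mem isCompact_univ.isBounded trivial trivial

/-- A family admitting distance-nondecreasing maps into a fixed compact space is uniformly
compact. -/
theorem uniformlyCompact_of_expanding {I : Type} {X : I → Type} [∀ σ, MetricSpace (X σ)]
    (Y : Type) [MetricSpace Y] [CompactSpace Y]
    (h : ∀ σ, ∃ g : X σ → Y, ∀ a b, dist a b ≤ dist (g a) (g b)) : UniformlyCompact I X := by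
  constructor
  · refine ⟨Metric.diam (Set.univ : Set Y), fun σ => ?_⟩
    obtain ⟨g, hg⟩ := h σ
    exact Metric.diam_le_of_forall_dist_le Metric.diam_nonneg
      fun a _ b _ => (hg a b).trans (dist_le_diam_univ _ _)
  · intro ε hε
    obtain ⟨N, hN⟩ := exists_packingBound Y hε
    refine ⟨N, fun σ => ?_⟩
    obtain ⟨g, hg⟩ := h σ
    exact (hN.of_expanding g hg).exists_net hε

theorem DomOrderSub.exists_expanding {X Y : Type} [MetricSpace X] [MetricSpace Y]
    (h : DomOrderSub X Y) : ∃ g : X → Y, ∀ a b, dist a b ≤ dist (g a) (g b) := by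
  obtain ⟨K, -, -, f, hf, hs⟩ := h
  refine ⟨fun x => (Function.surjInv hs x : K), fun a b => ?_⟩
  have h := hf (Function.surjInv hs a) (Function.surjInv hs b)
  rwa [Function.surjInv_eq hs, Function.surjInv_eq hs] at h

theorem DomOrder.domOrderSub {X Y : Type} [MetricSpace X] [MetricSpace Y] [Nonempty Y]
    (h : DomOrder X Y) : DomOrderSub X Y := by
  obtain ⟨f, hf, hs⟩ := h
  refine ⟨Set.univ, Set.univ_nonempty, isClosed_univ, fun y => f y, fun a b => hf a b,
    fun x => ?_⟩
  obtain ⟨y, rfl⟩ := hs x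
  exact ⟨⟨y, trivial⟩, rfl⟩

theorem DomOrder.prod {X Y : Type} (W : Type) [MetricSpace X] [MetricSpace Y] [MetricSpace W]
    [Nonempty W] (h : DomOrder X Y) : DomOrder X (Y × W) := by
  obtain ⟨f, hf, hs⟩ := h
  exact ⟨fun p => f p.1, fun a b => (hf a.1 b.1).trans (le_max_left _ _),
    hs.comp Prod.fst_surjective⟩

theorem DomOrderIso.prod {X W : Type} (Y : Type) [MetricSpace X] [MetricSpace Y] [MetricSpace W]
    [Nonempty Y] (h : DomOrderIso X W) : DomOrderIso X (Y × W) := by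
  obtain ⟨f, hf⟩ := h
  obtain ⟨y⟩ := ‹Nonempty Y›
  exact ⟨fun x => (y, f x), Isometry.of_dist_eq fun a b => by simp [Prod.dist_eq, hf.dist_eq]⟩

/-- The function `y ↦ dist x (f y)` attached to a point `x` of a non-expansive image of `Y`. -/
noncomputable def distFun {X Y : Type} [MetricSpace X] [MetricSpace Y] [CompactSpace Y]
    (f : Y → X) (hf : IsNonexpansive f) (x : X) : BoundedContinuousFunction Y ℝ :=
  BoundedContinuousFunction.mkOfCompact
    ⟨fun y => dist x (f y), continuous_const.dist hf.continuous⟩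

theorem isometry_distFun {X Y : Type} [MetricSpace X] [MetricSpace Y] [CompactSpace Y]
    (f : Y → X) (hf : IsNonexpansive f) (hs : Function.Surjective f) :
    Isometry (distFun f hf) := by
  refine Isometry.of_dist_eq fun a b => le_antisymm ?_ ?_
  · refine (BoundedContinuousFunction.dist_le dist_nonneg).2 fun y => ?_
    exact abs_dist_sub_le a b (f y)
  · obtain ⟨y, hy⟩ := hs b
    have h := BoundedContinuousFunction.dist_coe_le_dist
      (f := distFun f hf a) (g := distFun f hf b) y
    simpa [distFun, hy] using h

/-- The bounded `1`-Lipschitz functions on a compact space form a compact space containing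
every non-expansive image of it. -/
theorem exists_compact_domOrderIso (Y : Type) [MetricSpace Y] [CompactSpace Y] [Nonempty Y] :
    ∃ (W : Type) (_ : MetricSpace W) (_ : CompactSpace W) (_ : Nonempty W),
      ∀ (X : Type) [MetricSpace X], DomOrder X Y → DomOrderIso X W := by
  let D := Metric.diam (Set.univ : Set Y)
  let A : Set (BoundedContinuousFunction Y ℝ) :=
    {g | LipschitzWith 1 g ∧ ∀ y, g y ∈ Set.Icc 0 D}
  have hA : IsCompact (closure A) := by
    refine BoundedContinuousFunction.arzela_ascoli (Set.Icc 0 D) isCompact_Icc A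
      (fun g y hg => hg.2 y) ?_
    exact (LipschitzWith.uniformEquicontinuous (fun g : A => (g : Y → ℝ)) 1
      fun g => g.2.1).equicontinuous
  refine ⟨closure A, inferInstance, isCompact_iff_compactSpace.1 hA,
    ⟨0, subset_closure ⟨LipschitzWith.const' 0, fun y => ⟨le_rfl, Metric.diam_nonneg⟩⟩⟩, ?_⟩
  rintro X _ ⟨f, hf, hs⟩
  refine ⟨fun x => ⟨distFun f hf x, subset_closure ⟨?_, fun y => ⟨dist_nonneg, ?_⟩⟩⟩, ?_⟩
  · refine LipschitzWith.of_dist_le_mul fun y z => ?_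
    simpa [distFun] using (dist_dist_dist_le_right x (f y) (f z)).trans (hf y z)
  · obtain ⟨z, rfl⟩ := hs x
    exact (hf z y).trans (dist_le_diam_univ z y)
  · exact isometry_distFun f hf hs

theorem exists_common_bound {I : Type} {X : I → Type} [∀ σ, MetricSpace (X σ)]
    (Y : Type) [MetricSpace Y] [CompactSpace Y] [Nonempty Y] (h : ∀ σ, DomOrder (X σ) Y) :
    ∃ (Z : Type) (_ : MetricSpace Z) (_ : CompactSpace Z) (_ : Nonempty Z),
      ∀ σ, DomOrder (X σ) Z ∧ DomOrderSub (X σ) Z ∧ DomOrderIso (X σ) Z := by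
  obtain ⟨W, _, _, _, hW⟩ := exists_compact_domOrderIso Y
  exact ⟨Y × W, inferInstance, inferInstance, inferInstance, fun σ =>
    ⟨(h σ).prod W, ((h σ).prod W).domOrderSub, (hW _ (h σ)).prod Y⟩⟩

/-- Compatible families of points of an inverse system. -/
def Thread {I : Type} [PartialOrder I] {X : I → Type}
    (α : ∀ σ τ : I, σ ≤ τ → X τ → X σ) : Type :=
  {x : ∀ σ, X σ // ∀ (σ τ : I) (h : σ ≤ τ), α σ τ h (x τ) = x σ}

section InverseSystem

variable {I : Type} [PartialOrder I] {X : I → Type} [∀ σ, MetricSpace (X σ)]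
  {α : ∀ σ τ : I, σ ≤ τ → X τ → X σ}

theorem exists_thread_through [IsDirected I (· ≤ ·)]
    [∀ σ, CompactSpace (X σ)] [∀ σ, Nonempty (X σ)]
    (h_ne : ∀ (σ τ : I) (h : σ ≤ τ), IsNonexpansive (α σ τ h))
    (h_comp : ∀ (σ ϱ τ : I) (h₁ : σ ≤ ϱ) (h₂ : ϱ ≤ τ) (x : X τ),
      α σ ϱ h₁ (α ϱ τ h₂ x) = α σ τ (h₁.trans h₂) x)
    (h_surj : ∀ (σ τ : I) (h : σ ≤ τ), Function.Surjective (α σ τ h))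
    (σ₀ : I) (x₀ : X σ₀) : ∃ x : Thread α, x.1 σ₀ = x₀ := by
  classical
  let T : I → Set (∀ σ, X σ) := fun τ => {x | x σ₀ = x₀ ∧ ∀ σ h, α σ τ h (x τ) = x σ}
  have hclosed : ∀ τ, IsClosed (T τ) := by
    intro τ
    simp only [T, Set.ofPred_and, Set.ofPred_forall]
    refine (isClosed_eq (continuous_apply σ₀) continuous_const).inter ?_
    exact isClosed_iInter fun σ => isClosed_iInter fun h =>
      isClosed_eq ((h_ne σ τ h).continuous.comp (continuous_apply τ)) (continuous_apply σ)
  have hne : ∀ τ, (T τ).Nonempty := by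
    intro τ
    obtain ⟨ϱ, h₀, hτ⟩ := exists_ge_ge σ₀ τ
    obtain ⟨y, hy⟩ := h_surj σ₀ ϱ h₀ x₀
    refine ⟨fun σ => if h : σ ≤ ϱ then α σ ϱ h y else Classical.arbitrary _, ?_, ?_⟩
    · simp [h₀, hy]
    · intro σ h
      simp [hτ, h.trans hτ, h_comp]
  have hdir : Directed (· ⊇ ·) T := by
    have hanti : ∀ τ ϱ, τ ≤ ϱ → T ϱ ⊆ T τ := by
      rintro τ ϱ hle x ⟨hx₀, hx⟩
      refine ⟨hx₀, fun σ h => ?_⟩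
      rw [← hx τ hle, h_comp, hx]
    intro τ τ'
    obtain ⟨ϱ, h, h'⟩ := exists_ge_ge τ τ'
    exact ⟨ϱ, hanti _ _ h, hanti _ _ h'⟩
  have : Nonempty I := ⟨σ₀⟩
  obtain ⟨x, hx⟩ := IsCompact.nonempty_iInter_of_directed_nonempty_isCompact_isClosed T hdir hne
    (fun τ => (hclosed τ).isCompact) hclosed
  rw [Set.mem_iInter] at hx
  exact ⟨⟨x, fun σ τ h => (hx τ).2 σ h⟩, (hx σ₀).1⟩

theorem IsInverseLimit.surjective [IsDirected I (· ≤ ·)]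
    [∀ σ, CompactSpace (X σ)] [∀ σ, Nonempty (X σ)]
    (h_ne : ∀ (σ τ : I) (h : σ ≤ τ), IsNonexpansive (α σ τ h))
    (h_comp : ∀ (σ ϱ τ : I) (h₁ : σ ≤ ϱ) (h₂ : ϱ ≤ τ) (x : X τ),
      α σ ϱ h₁ (α ϱ τ h₂ x) = α σ τ (h₁.trans h₂) x)
    (h_surj : ∀ (σ τ : I) (h : σ ≤ τ), Function.Surjective (α σ τ h))
    {L : Type} [MetricSpace L] [CompactSpace L] [Nonempty L] {f : ∀ σ, L → X σ}
    (hL : IsInverseLimit I X α L f) (σ : I) : Function.Surjective (f σ) := by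
  intro x₀
  obtain ⟨x, rfl⟩ := exists_thread_through h_ne h_comp h_surj σ x₀
  obtain ⟨ν, ⟨-, hν⟩, -⟩ := hL.2.2 PUnit inferInstance inferInstance inferInstance
    (fun σ _ => x.1 σ) (fun σ a b => by simp) (fun σ τ h _ => x.2 σ τ h)
  exact ⟨ν PUnit.unit, hν σ PUnit.unit⟩

theorem bddAbove_dist_threads {C : ℝ} (hC : ∀ σ (a b : X σ), dist a b ≤ C) (x y : Thread α) :
    BddAbove (Set.range fun σ => dist (x.1 σ) (y.1 σ)) :=
  ⟨C, by rintro _ ⟨σ, rfl⟩; exact hC _ _ _⟩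

/-- The supremum metric on the threads of an inverse system of uniformly bounded spaces. -/
noncomputable abbrev threadMetricSpace [Nonempty I] {C : ℝ}
    (hC : ∀ σ (a b : X σ), dist a b ≤ C) : MetricSpace (Thread α) where
  dist x y := ⨆ σ, dist (x.1 σ) (y.1 σ)
  dist_self x := by simp
  dist_comm x y := by simp only [dist_comm]
  dist_triangle x y z := ciSup_le fun σ => (dist_triangle _ (y.1 σ) _).trans <|
    add_le_add (le_ciSup (bddAbove_dist_threads hC x y) σ)
      (le_ciSup (bddAbove_dist_threads hC y z) σ)
  eq_of_dist_eq_zero {x y} h := Subtype.ext <| funext fun σ => dist_le_zero.1 <|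
    (le_ciSup (bddAbove_dist_threads hC x y) σ).trans h.le

section Metric

variable [Nonempty I] {C : ℝ} (hC : ∀ σ (a b : X σ), dist a b ≤ C)

theorem thread_dist_le_iff {x y : Thread α} {r : ℝ} :
    (threadMetricSpace hC).dist x y ≤ r ↔ ∀ σ, dist (x.1 σ) (y.1 σ) ≤ r :=
  ciSup_le_iff (bddAbove_dist_threads hC x y)

theorem completeSpace_thread [∀ σ, CompactSpace (X σ)]
    (h_ne : ∀ (σ τ : I) (h : σ ≤ τ), IsNonexpansive (α σ τ h)) :
    @CompleteSpace (Thread α) (threadMetricSpace hC).toUniformSpace := by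
  let _ := threadMetricSpace (α := α) hC
  have hle {x y : Thread α} {r : ℝ} : dist x y ≤ r ↔ ∀ σ, dist (x.1 σ) (y.1 σ) ≤ r :=
    thread_dist_le_iff hC
  refine Metric.complete_of_cauchySeq_tendsto fun u hu => ?_
  have hcoord : ∀ σ, CauchySeq fun n => (u n).1 σ := fun σ => by
    refine Metric.cauchySeq_iff.2 fun ε hε => ?_
    obtain ⟨N, hN⟩ := Metric.cauchySeq_iff.1 hu ε hε
    exact ⟨N, fun m hm n hn => (hle.1 le_rfl σ).trans_lt (hN m hm n hn)⟩
  choose x hx using fun σ => cauchySeq_tendsto_of_complete (hcoord σ)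
  refine ⟨⟨x, fun σ τ h => ?_⟩, ?_⟩
  · refine tendsto_nhds_unique (((h_ne σ τ h).continuous.tendsto _).comp (hx τ)) ?_
    simpa only [Function.comp_def, (u _).2 σ τ h] using hx σ
  · refine Metric.tendsto_atTop.2 fun ε hε => ?_
    obtain ⟨N, hN⟩ := Metric.cauchySeq_iff.1 hu (ε / 2) (half_pos hε)
    refine ⟨N, fun n hn => lt_of_le_of_lt (hle.2 fun σ => ?_) (half_lt_self hε)⟩
    refine le_of_tendsto (tendsto_const_nhds.dist (hx σ)) ?_
    filter_upwards [eventually_ge_atTop N] with m hm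
    exact (hle.1 le_rfl σ).trans (hN n hn m hm).le

theorem packingBound_thread [IsDirected I (· ≤ ·)]
    (h_ne : ∀ (σ τ : I) (h : σ ≤ τ), IsNonexpansive (α σ τ h)) {ε : ℝ} (hε : 0 < ε) {N : ℕ}
    (hN : ∀ σ, PackingBound (X σ) (ε / 2) N) :
    @PackingBound (Thread α) (threadMetricSpace hC) ε N := by
  classical
  let _ := threadMetricSpace (α := α) hC
  intro s hs
  have hsep : ∀ p : Thread α × Thread α, ∃ σ, p.1 ∈ s → p.2 ∈ s → p.1 ≠ p.2 →
      ε / 2 < dist (p.1.1 σ) (p.2.1 σ) := by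
    intro p
    by_contra! hcon
    obtain ⟨σ⟩ := ‹Nonempty I›
    obtain ⟨h₁, h₂, h₃, -⟩ := hcon σ
    have h₄ : dist p.1 p.2 ≤ ε / 2 := (thread_dist_le_iff hC).2 fun τ => (hcon τ).2.2.2
    linarith [hs _ h₁ _ h₂ h₃]
  choose g hg using hsep
  obtain ⟨τ, hτ⟩ := ((s ×ˢ s).image g).exists_le
  have hfar : ∀ a ∈ s, ∀ b ∈ s, a ≠ b → ε / 2 < dist (a.1 τ) (b.1 τ) := by
    intro a ha b hb hab
    have hle : g (a, b) ≤ τ :=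
      hτ _ (Finset.mem_image_of_mem g (Finset.mem_product.2 ⟨ha, hb⟩))
    have h := h_ne _ _ hle (a.1 τ) (b.1 τ)
    rw [a.2, b.2] at h
    exact (hg (a, b) ha hb hab).trans_le h
  have hinj : Set.InjOn (fun a : Thread α => a.1 τ) s := by
    intro a ha b hb hab
    by_contra hne
    have h := hfar a ha b hb hne
    simp only at hab
    rw [hab, dist_self] at h
    linarith
  rw [← Finset.card_image_of_injOn hinj]
  refine hN τ _ fun x hx y hy hxy => ?_
  obtain ⟨a, ha, rfl⟩ := Finset.mem_image.1 hx
  obtain ⟨b, hb, rfl⟩ := Finset.mem_image.1 hy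
  exact (hfar a ha b hb fun h => hxy (h ▸ rfl)).le

theorem compactSpace_thread [IsDirected I (· ≤ ·)] [∀ σ, CompactSpace (X σ)]
    (h_ne : ∀ (σ τ : I) (h : σ ≤ τ), IsNonexpansive (α σ τ h))
    (hpack : ∀ ε : ℝ, 0 < ε → ∃ N, ∀ σ, PackingBound (X σ) ε N) :
    @CompactSpace (Thread α) (threadMetricSpace hC).toUniformSpace.toTopologicalSpace := by
  let _ := threadMetricSpace (α := α) hC
  have := completeSpace_thread hC h_ne
  refine ⟨TotallyBounded.isCompact_of_isClosed ?_ isClosed_univ⟩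
  refine Metric.totallyBounded_iff.2 fun ε hε => ?_
  obtain ⟨N, hN⟩ := hpack (ε / 2) (half_pos hε)
  obtain ⟨s, -, hs⟩ := (packingBound_thread hC h_ne hε hN).exists_net hε
  exact ⟨s, s.finite_toSet, fun x _ => by simpa using hs x⟩

end Metric

theorem exists_inverseLimit [IsDirected I (· ≤ ·)] [Nonempty I]
    [∀ σ, CompactSpace (X σ)] [∀ σ, Nonempty (X σ)]
    (h_ne : ∀ (σ τ : I) (h : σ ≤ τ), IsNonexpansive (α σ τ h))
    (h_comp : ∀ (σ ϱ τ : I) (h₁ : σ ≤ ϱ) (h₂ : ϱ ≤ τ) (x : X τ),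
      α σ ϱ h₁ (α ϱ τ h₂ x) = α σ τ (h₁.trans h₂) x)
    (h_surj : ∀ (σ τ : I) (h : σ ≤ τ), Function.Surjective (α σ τ h))
    (hX : UniformlyCompact I X) :
    ∃ (L : Type) (_ : MetricSpace L) (_ : CompactSpace L) (_ : Nonempty L)
      (f : ∀ σ, L → X σ), IsInverseLimit I X α L f := by
  obtain ⟨⟨C, hdiam⟩, hnet⟩ := hX
  have hC : ∀ σ (a b : X σ), dist a b ≤ C := fun σ a b =>
    (dist_le_diam_univ a b).trans (hdiam σ)
  have hpack : ∀ ε : ℝ, 0 < ε → ∃ N, ∀ σ, PackingBound (X σ) ε N := by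
    intro ε hε
    obtain ⟨N, hN⟩ := hnet (ε / 2) (half_pos hε)
    refine ⟨N, fun σ => ?_⟩
    obtain ⟨s, hs, hs'⟩ := hN σ
    exact packingBound_of_net s hs hs'
  have hL : Nonempty (Thread α) := by
    obtain ⟨σ⟩ := ‹Nonempty I›
    obtain ⟨x⟩ := ‹∀ σ, Nonempty (X σ)› σ
    obtain ⟨y, -⟩ := exists_thread_through h_ne h_comp h_surj σ x
    exact ⟨y⟩
  refine ⟨Thread α, threadMetricSpace hC, compactSpace_thread hC h_ne hpack, hL,
    fun σ x => x.1 σ, fun σ a b => (thread_dist_le_iff hC).1 le_rfl σ,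
    fun σ τ h x => x.2 σ τ h, ?_⟩
  intro Z _ _ _ ξ hξ hcompat
  refine ⟨fun z => ⟨fun σ => ξ σ z, fun σ τ h => hcompat σ τ h z⟩,
    ⟨fun a b => (thread_dist_le_iff hC).2 fun σ => hξ σ a b, fun σ z => rfl⟩, ?_⟩
  rintro ν ⟨-, hν⟩
  funext z
  exact Subtype.ext (funext fun σ => hν σ z)

end InverseSystem

/-- **Theorem (characterisation of the existence of inverse limits in cmn).** -/
theorem inverse_limit_tfae
    (I : Type) [PartialOrder I] [IsDirected I (· ≤ ·)] [Nonempty I]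
    (X : I → Type) [∀ σ, MetricSpace (X σ)] [∀ σ, CompactSpace (X σ)] [∀ σ, Nonempty (X σ)]
    (α : ∀ σ τ : I, σ ≤ τ → X τ → X σ)
    (h_ne : ∀ (σ τ : I) (h : σ ≤ τ), IsNonexpansive (α σ τ h))
    (h_id : ∀ (σ : I) (x : X σ), α σ σ le_rfl x = x)
    (h_comp : ∀ (σ ϱ τ : I) (h₁ : σ ≤ ϱ) (h₂ : ϱ ≤ τ) (x : X τ),
      α σ ϱ h₁ (α ϱ τ h₂ x) = α σ τ (h₁.trans h₂) x)
    (h_surj : ∀ (σ τ : I) (h : σ ≤ τ), Function.Surjective (α σ τ h)) :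
    [(∃ (L : Type) (_ : MetricSpace L) (_ : CompactSpace L) (_ : Nonempty L)
        (f : ∀ σ, L → X σ), IsInverseLimit I X α L f),
     (∃ (Y : Type) (_ : MetricSpace Y) (_ : CompactSpace Y) (_ : Nonempty Y),
        ∀ σ, DomOrder (X σ) Y),
     (∃ (Y : Type) (_ : MetricSpace Y) (_ : CompactSpace Y) (_ : Nonempty Y),
        ∀ σ, DomOrderSub (X σ) Y),
     (∃ (Y : Type) (_ : MetricSpace Y) (_ : CompactSpace Y) (_ : Nonempty Y),
        ∀ σ, DomOrderIso (X σ) Y),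
     (∃ (Y : Type) (_ : MetricSpace Y) (_ : CompactSpace Y) (_ : Nonempty Y),
        ∀ σ, DomOrder (X σ) Y ∧ DomOrderSub (X σ) Y ∧ DomOrderIso (X σ) Y),
     UniformlyCompact I X].TFAE := by
  tfae_have 1 → 2 := by
    rintro ⟨L, _, _, _, f, hf⟩
    exact ⟨L, _, ‹_›, ‹_›, fun σ => ⟨f σ, hf.1 σ, hf.surjective h_ne h_comp h_surj σ⟩⟩
  tfae_have 2 → 5 := by
    rintro ⟨Y, _, _, _, hY⟩
    exact exists_common_bound Y hY
  tfae_have 5 → 3 := by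
    rintro ⟨Y, _, _, _, hY⟩
    exact ⟨Y, _, ‹_›, ‹_›, fun σ => (hY σ).2.1⟩
  tfae_have 5 → 4 := by
    rintro ⟨Y, _, _, _, hY⟩
    exact ⟨Y, _, ‹_›, ‹_›, fun σ => (hY σ).2.2⟩
  tfae_have 3 → 6 := by
    rintro ⟨Y, _, _, _, hY⟩
    exact uniformlyCompact_of_expanding Y fun σ => (hY σ).exists_expanding
  tfae_have 4 → 6 := by
    rintro ⟨Y, _, _, _, hY⟩
    refine uniformlyCompact_of_expanding Y fun σ => ?_
    obtain ⟨g, hg⟩ := hY σ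
    exact ⟨g, fun a b => (hg.dist_eq a b).ge⟩
  tfae_have 6 → 1 := exists_inverseLimit h_ne h_comp h_surj
  tfae_finish
end

section
/- Let Σ be a nonempty directed partial order and ({X^σ}, {α_τ^σ}) an inverse system in cmn over Σ in which every arrow α_τ^σ (σ ≤ τ) is surjective, and suppose there exist a nonempty compact metric space Y and, for every σ, a non-expansive surjection from Y onto X^σ. Then the net σ ↦ toGHSpace X^σ converges in GHSpace along the atTop filter on Σ. -/
open GromovHausdorff Filter Topology

/-- A map lying between two compact metric spaces with distortion at most `ε` bounds their
Gromov–Hausdorff distance. -/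
theorem dist_toGHSpace_le_of_surjective {X Y : Type} [MetricSpace X] [CompactSpace X] [Nonempty X]
    [MetricSpace Y] [CompactSpace Y] [Nonempty Y] {f : X → Y} (hf : Function.Surjective f)
    {ε : ℝ} (h : ∀ a b, |dist a b - dist (f a) (f b)| ≤ ε) :
    dist (toGHSpace X) (toGHSpace Y) ≤ ε / 2 := by
  have key := ghDist_le_of_approx_subsets (s := (Set.univ : Set X)) (fun x => f x)
    (ε₁ := 0) (ε₂ := ε) (ε₃ := 0) (fun x => ⟨x, Set.mem_univ x, by simp⟩)
    (fun y => by
      obtain ⟨x, rfl⟩ := hf y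
      exact ⟨⟨x, Set.mem_univ x⟩, by simp⟩)
    (fun a b => h a b)
  have : ghDist X Y ≤ ε / 2 := by simpa using key
  exact this

/-- A pointwise limit along an ultrafilter of non-expansive surjections from a compact space is
surjective. -/
theorem surjective_of_tendsto_ultrafilter {I X Y : Type} [MetricSpace X] [MetricSpace Y]
    [CompactSpace Y] [Nonempty Y] (U : Ultrafilter I) {F : I → Y → X} {f : Y → X}
    (hF : ∀ᶠ i in (U : Filter I), IsNonexpansive (F i) ∧ Function.Surjective (F i))
    (hf : ∀ y, Tendsto (fun i => F i y) U (𝓝 (f y))) : Function.Surjective f := by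
  intro x
  obtain ⟨c, hc⟩ := (hF.mono fun i hi => hi.2 x).choice
  obtain ⟨y, hy⟩ : ∃ y, Tendsto c U (𝓝 y) := ⟨_, (U.map c).le_nhds_lim⟩
  refine ⟨y, dist_le_zero.1 ?_⟩
  have h₁ : Tendsto (fun i => dist (F i y) x) U (𝓝 (dist (f y) x)) :=
    (hf y).dist tendsto_const_nhds
  have h₂ : Tendsto (fun i => dist y (c i)) U (𝓝 0) := by
    simpa using (tendsto_const_nhds (x := y)).dist hy
  refine le_of_tendsto_of_tendsto h₁ h₂ ?_
  filter_upwards [hF, hc] with i hi hci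
  simpa only [hci] using hi.1 y (c i)

/-- An inverse system of compact metric spaces with non-expansive arrows that receives a
non-expansive surjection onto each of its members from a compact space `Y` receives a compatible
family of such surjections. -/
theorem exists_compatible_nonexpansive_surjections
    {I : Type} [PartialOrder I] [IsDirected I (· ≤ ·)] [Nonempty I]
    {X : I → Type} [∀ σ, MetricSpace (X σ)] [∀ σ, CompactSpace (X σ)] [∀ σ, Nonempty (X σ)]
    {α : ∀ σ τ : I, σ ≤ τ → X τ → X σ}
    (h_ne : ∀ (σ τ : I) (h : σ ≤ τ), IsNonexpansive (α σ τ h))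
    (h_comp : ∀ (σ ϱ τ : I) (h₁ : σ ≤ ϱ) (h₂ : ϱ ≤ τ) (x : X τ),
      α σ ϱ h₁ (α ϱ τ h₂ x) = α σ τ (h₁.trans h₂) x)
    (h_surj : ∀ (σ τ : I) (h : σ ≤ τ), Function.Surjective (α σ τ h))
    {Y : Type} [MetricSpace Y] [CompactSpace Y] [Nonempty Y]
    (h_bdd : ∀ σ, ∃ g : Y → X σ, IsNonexpansive g ∧ Function.Surjective g) :
    ∃ f : ∀ σ, Y → X σ, (∀ σ, IsNonexpansive (f σ)) ∧ (∀ σ, Function.Surjective (f σ)) ∧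
      ∀ (σ τ : I) (h : σ ≤ τ) (y : Y), α σ τ h (f τ y) = f σ y := by
  classical
  choose g hg_ne hg_surj using h_bdd
  let U : Ultrafilter I := Ultrafilter.of atTop
  have hU : ∀ σ, ∀ᶠ τ in (U : Filter I), σ ≤ τ := fun σ =>
    Ultrafilter.of_le atTop (eventually_ge_atTop σ)
  let F : ∀ σ, I → Y → X σ := fun σ τ y => if h : σ ≤ τ then α σ τ h (g τ y) else g σ y
  have hF : ∀ σ τ (h : σ ≤ τ), F σ τ = α σ τ h ∘ g τ := fun σ τ h => by
    ext y
    simp [F, h]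
  have hF_ne : ∀ σ τ, σ ≤ τ → IsNonexpansive (F σ τ) := fun σ τ h a b => by
    rw [hF σ τ h]
    exact (h_ne σ τ h _ _).trans (hg_ne τ a b)
  have hlim : ∀ σ y, ∃ x, Tendsto (fun τ => F σ τ y) U (𝓝 x) := fun σ y =>
    ⟨_, (U.map fun τ => F σ τ y).le_nhds_lim⟩
  choose f hf using hlim
  refine ⟨f, fun σ a b => ?_, fun σ => ?_, fun σ τ h y => ?_⟩
  · exact le_of_tendsto ((hf σ a).dist (hf σ b)) ((hU σ).mono fun τ h => hF_ne σ τ h a b)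
  · refine surjective_of_tendsto_ultrafilter U ((hU σ).mono fun τ h => ⟨hF_ne σ τ h, ?_⟩) (hf σ)
    rw [hF σ τ h]
    exact (h_surj σ τ h).comp (hg_surj τ)
  · have hα : Continuous (α σ τ h) := (LipschitzWith.mk_one (h_ne σ τ h)).continuous
    refine tendsto_nhds_unique ((hα.tendsto _).comp (hf τ y)) ((hf σ y).congr' ?_)
    filter_upwards [hU τ] with ϱ hϱ
    simp [hF σ ϱ (h.trans hϱ), hF τ ϱ hϱ, h_comp]

/-- **Corollary.** The net of objects of an inverse system in cmn with surjective
non-expansive arrows which is bounded from above with respect to `≼` converges in the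
Gromov–Hausdorff space. -/
theorem inverse_system_net_converges_in_GHSpace
    (I : Type) [PartialOrder I] [IsDirected I (· ≤ ·)] [Nonempty I]
    (X : I → Type) [∀ σ, MetricSpace (X σ)] [∀ σ, CompactSpace (X σ)] [∀ σ, Nonempty (X σ)]
    (α : ∀ σ τ : I, σ ≤ τ → X τ → X σ)
    (h_ne : ∀ (σ τ : I) (h : σ ≤ τ), IsNonexpansive (α σ τ h))
    (h_id : ∀ (σ : I) (x : X σ), α σ σ le_rfl x = x)
    (h_comp : ∀ (σ ϱ τ : I) (h₁ : σ ≤ ϱ) (h₂ : ϱ ≤ τ) (x : X τ),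
      α σ ϱ h₁ (α ϱ τ h₂ x) = α σ τ (h₁.trans h₂) x)
    (h_surj : ∀ (σ τ : I) (h : σ ≤ τ), Function.Surjective (α σ τ h))
    (Y : Type) [MetricSpace Y] [CompactSpace Y] [Nonempty Y]
    (h_bdd : ∀ σ, ∃ g : Y → X σ, IsNonexpansive g ∧ Function.Surjective g) :
    ∃ p : GHSpace, Tendsto (fun σ => toGHSpace (X σ)) atTop (𝓝 p) := by
  obtain ⟨f, hf_ne, hf_surj, hf⟩ :=
    exists_compatible_nonexpansive_surjections h_ne h_comp h_surj h_bdd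
  have hf_cont : ∀ σ, Continuous (f σ) := fun σ =>
    (LipschitzWith.mk_one (hf_ne σ)).continuous
  let d : I → Y × Y → ℝ := fun σ p => dist (f σ p.1) (f σ p.2)
  have hd_le : ∀ σ p, d σ p ≤ dist p.1 p.2 := fun σ p => hf_ne σ p.1 p.2
  have hd_mono : Monotone d := fun σ τ h p => by
    simpa only [d, hf] using h_ne σ τ h (f τ p.1) (f τ p.2)
  have hd_bdd : ∀ p, BddAbove (Set.range fun σ => d σ p) := fun p =>
    ⟨dist p.1 p.2, by rintro _ ⟨σ, rfl⟩; exact hd_le σ p⟩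
  have hd_lip : ∀ σ, LipschitzWith 2 (d σ) := fun σ => LipschitzWith.of_dist_le_mul fun p q => by
    have h₁ := dist_dist_dist_le (f σ p.1) (f σ p.2) (f σ q.1) (f σ q.2)
    have h₂ := hf_ne σ p.1 q.1
    have h₃ := hf_ne σ p.2 q.2
    have h₄ : dist p.1 q.1 ≤ dist p q := le_max_left _ _
    have h₅ : dist p.2 q.2 ≤ dist p q := le_max_right _ _
    simp only [d, NNReal.coe_ofNat]
    linarith
  have hd_lim : ∀ p, Tendsto (fun σ => d σ p) atTop (𝓝 (⨆ σ, d σ p)) := fun p =>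
    tendsto_atTop_ciSup (fun _ _ h => hd_mono h p) (hd_bdd p)
  have hlim_cont : Continuous fun p => ⨆ σ, d σ p := by
    refine (LipschitzWith.of_dist_le_mul (K := 2) fun p q => ?_).continuous
    exact le_of_tendsto ((hd_lim p).dist (hd_lim q))
      (Eventually.of_forall fun σ => (hd_lip σ).dist_le_mul p q)
  have hunif : TendstoUniformly d (fun p => ⨆ σ, d σ p) atTop :=
    Monotone.tendstoUniformly_of_forall_tendsto (fun σ => (hd_lip σ).continuous)
      hd_mono hlim_cont hd_lim
  refine cauchySeq_tendsto_of_complete (Metric.cauchy_iff.2 ⟨inferInstance, fun ε hε => ?_⟩)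
  obtain ⟨σ₀, hσ₀⟩ := ((Metric.tendstoUniformly_iff.1 hunif) (ε / 2) (half_pos hε)).exists
  have hclose : ∀ σ, σ₀ ≤ σ → dist (toGHSpace (X σ)) (toGHSpace (X σ₀)) ≤ ε / 2 / 2 := by
    refine fun σ h => dist_toGHSpace_le_of_surjective (h_surj σ₀ σ h) fun a b => ?_
    obtain ⟨x, rfl⟩ := hf_surj σ a
    obtain ⟨y, rfl⟩ := hf_surj σ b
    have h₁ := h_ne σ₀ σ h (f σ x) (f σ y)
    have h₂ : dist (f σ x) (f σ y) ≤ ⨆ σ, d σ (x, y) := le_ciSup (hd_bdd (x, y)) σ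
    have h₃ := (le_abs_self _).trans_lt (hσ₀ (x, y))
    simp only [d] at h₂ h₃
    rw [abs_of_nonneg (sub_nonneg.2 h₁), hf, hf]
    linarith
  refine ⟨_, image_mem_map (mem_atTop σ₀), ?_⟩
  rintro _ ⟨σ, hσ, rfl⟩ _ ⟨τ, hτ, rfl⟩
  refine (dist_triangle_right _ _ (toGHSpace (X σ₀))).trans_lt ?_
  linarith [hclose σ hσ, hclose τ hτ]
end
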